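/- Let n ≥ 3, j ∈ ℕ, and let p : ℝⁿ → ℂ be a homogeneous polynomial function of degree j with Δp = 0. Set λ = j(j+n−2), let ϝ ∈ ℝ with ((n−2)/2)² + λ + ϝ > 0, and set s = √(((n−2)/2)² + λ + ϝ), α = −(n−2)/2 + s. Let σ ∈ ℂ and set a = 1/2 + s, b = 1/2 + s + iσ, c = 1 + 2s. If y : (0,1) → ℂ is twice continuously differentiable and satisfies the hypergeometric equation with parameters (a,b,c), namely x(1−x)y''(x) + (c − (a+b+1)x)y'(x) − a b y(x) = 0 on (0,1), then the function u(t,x) = p(x) |x|^{−j} (t+|x|)^{−(iσ+(n−1)/2)} (2|x|/(t+|x|))^{α} y(2|x|/(t+|x|)) satisfies ∂_t² u − Δ_x u + ϝ |x|^{−2} u = 0 at every point of the region {(t,x) ∈ ℝ × ℝⁿ : 0 < |x| < t}. -/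

import Mathlib

/-- The Euclidean Laplacian `Δf(x) = Σᵢ ∂ᵢ²f(x)` of a function `f : ℝⁿ → ℂ`. -/
noncomputable def lap {n : ℕ} (f : EuclideanSpace ℝ (Fin n) → ℂ)
    (x : EuclideanSpace ℝ (Fin n)) : ℂ :=
  ∑ i : Fin n,
    fderiv ℝ (fun y => fderiv ℝ f y (EuclideanSpace.single i 1)) x
      (EuclideanSpace.single i 1)

/-- The Gauss hypergeometric equation with parameters `(a, b, c)`:
`x(1−x)y'' + (c − (a+b+1)x)y' − a b y = 0`. -/
def hypergeomEq (a b c : ℂ) (y : ℝ → ℂ) (x : ℝ) : Prop :=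
  (x : ℂ) * (1 - (x : ℂ)) * deriv (deriv y) x
    + (c - (a + b + 1) * (x : ℂ)) * deriv y x - a * b * y x = 0

open Topology Filter in
lemma aux_norm {n : ℕ} {z : EuclideanSpace ℝ (Fin n)} (hz : z ≠ 0) :
    HasFDerivAt (fun w : EuclideanSpace ℝ (Fin n) => ‖w‖) ((1 / ‖z‖) • innerSL ℝ z) z := by
  have h := (hasStrictFDerivAt_norm_sq z).hasFDerivAt.sqrt (by simpa using hz)
  simp only [Real.sqrt_sq (norm_nonneg _)] at h
  convert! h using 1
  ext v
  have : ‖z‖ ≠ 0 := by simpa using hz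
  simp
  field_simp

lemma aux_comp {n : ℕ} {z : EuclideanSpace ℝ (Fin n)} (hz : z ≠ 0) {g : ℝ → ℂ} {g' : ℂ}
    (hg : HasDerivAt g g' ‖z‖) :
    HasFDerivAt (fun w : EuclideanSpace ℝ (Fin n) => g ‖w‖)
      (((1 / ‖z‖) • innerSL ℝ z).smulRight g') z := by
  have h := hg.hasFDerivAt.comp z (aux_norm hz)
  convert! h using 1

open Topology Filter in
lemma aux_lap {n : ℕ} {x : EuclideanSpace ℝ (Fin n)} (hx : x ≠ 0)
    {p : EuclideanSpace ℝ (Fin n) → ℂ} (hp : ContDiff ℝ 2 p) {g g1 : ℝ → ℂ} {g2 : ℂ}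
    (h1 : ∀ᶠ ρ in 𝓝 ‖x‖, HasDerivAt g (g1 ρ) ρ) (h2 : HasDerivAt g1 g2 ‖x‖) :
    lap (fun z => p z * g ‖z‖) x = lap p x * g ‖x‖ + 2 * (g1 ‖x‖ / ‖x‖) * fderiv ℝ p x x
      + p x * (g2 + (n - 1) / ‖x‖ * g1 ‖x‖) := by
  have hr : (‖x‖ : ℂ) ≠ 0 := by simpa using hx
  have hp1 : ∀ z, HasFDerivAt p (fderiv ℝ p z) z := fun z =>
    (hp.differentiable (by norm_num) z).hasFDerivAt
  have key : ∀ i : Fin n,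
      fderiv ℝ (fun y => fderiv ℝ (fun z => p z * g ‖z‖) y (EuclideanSpace.single i 1)) x
        (EuclideanSpace.single i 1)
      = fderiv ℝ (fun y => fderiv ℝ p y (EuclideanSpace.single i 1)) x
        (EuclideanSpace.single i 1) * g ‖x‖
        + 2 * (g1 ‖x‖ / ‖x‖) * (fderiv ℝ p x (EuclideanSpace.single i 1) * (x i : ℂ))
        + p x * (g1 ‖x‖ / ‖x‖)
        + p x * (g2 / ‖x‖ - g1 ‖x‖ / ‖x‖ ^ 2) / ‖x‖ * (x i : ℂ) ^ 2 := by
    intro i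
    set e : EuclideanSpace ℝ (Fin n) := EuclideanSpace.single i 1 with he
    have ev : (fun y => fderiv ℝ (fun z => p z * g ‖z‖) y e) =ᶠ[𝓝 x]
        fun y => fderiv ℝ p y e * g ‖y‖ + p y * ((g1 ‖y‖ / ‖y‖) * (y i : ℂ)) := by
      have c1 : ∀ᶠ z in 𝓝 x, HasDerivAt g (g1 ‖z‖) ‖z‖ :=
        (continuous_norm.tendsto x).eventually h1
      filter_upwards [c1, isOpen_ne.mem_nhds hx] with z hz hz0
      have := ((hp1 z).mul (aux_comp hz0 hz)).fderiv
      have e2 : fderiv ℝ (fun z => p z * g ‖z‖) z = _ := this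
      rw [e2]
      simp [he, EuclideanSpace.inner_single_right]
      ring
    rw [ev.fderiv_eq]
    have d1 : HasFDerivAt (fun y => fderiv ℝ p y e) (fderiv ℝ (fun y => fderiv ℝ p y e) x) x := by
      apply DifferentiableAt.hasFDerivAt
      have := (hp.fderiv_right (m := 1) (by norm_num)).differentiable (by norm_num)
      exact (this x).clm_apply (differentiableAt_const _)
    have d2 := aux_comp hx h1.self_of_nhds
    have d3 : HasDerivAt (fun ρ : ℝ => g1 ρ / (ρ : ℂ)) (g2 / ‖x‖ - g1 ‖x‖ / ‖x‖ ^ 2) ‖x‖ := by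
      have := h2.div (HasDerivAt.ofReal_comp (hasDerivAt_id ‖x‖)) (by simpa using hx)
      convert! this using 1
      simp
      field_simp
    have d4 : HasFDerivAt (fun y : EuclideanSpace ℝ (Fin n) => ((y i : ℝ) : ℂ))
        (Complex.ofRealCLM.comp (EuclideanSpace.proj i)) x :=
      (Complex.ofRealCLM.comp (EuclideanSpace.proj (𝕜 := ℝ) i)).hasFDerivAt
    have d := (d1.mul d2).add ((hp1 x).mul ((aux_comp hx d3).mul d4))
    have e2 : fderiv ℝ (fun y => fderiv ℝ p y e * g ‖y‖ + p y * ((g1 ‖y‖ / ‖y‖) * (y i : ℂ))) x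
      = _ := d.fderiv
    rw [e2]
    simp [he, EuclideanSpace.inner_single_right]
    ring
  have hsum : ∑ i, (x i : ℂ) ^ 2 = (‖x‖ : ℂ) ^ 2 := by
    have := EuclideanSpace.real_norm_sq_eq x
    rw [← Complex.ofReal_pow, this]; push_cast; rfl
  have hxx : fderiv ℝ p x x = ∑ i, fderiv ℝ p x (EuclideanSpace.single i 1) * (x i : ℂ) := by
    have : x = ∑ i, x i • (EuclideanSpace.single i (1:ℝ)) := by
      ext k
      simp [Pi.single_apply]
    refine (congrArg (fderiv ℝ p x) this).trans ?_
    rw [map_sum]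
    refine Finset.sum_congr rfl fun i _ => ?_
    rw [map_smul, Complex.real_smul, mul_comm]
  unfold lap
  simp only [key]
  rw [Finset.sum_add_distrib, Finset.sum_add_distrib, Finset.sum_add_distrib, ← Finset.mul_sum,
    ← Finset.mul_sum _ _ (p x * (g2 / ‖x‖ - g1 ‖x‖ / ‖x‖ ^ 2) / ‖x‖), hsum, ← Finset.sum_mul, ← hxx]
  simp
  field_simp
  ring

lemma aux_poly {n j : ℕ} {p : EuclideanSpace ℝ (Fin n) → ℂ}
    {P : MvPolynomial (Fin n) ℂ} (hP : P.IsHomogeneous j)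
    (hpP : ∀ x : EuclideanSpace ℝ (Fin n),
      p x = MvPolynomial.eval (fun i => ((x i : ℝ) : ℂ)) P) :
    ContDiff ℝ 2 p ∧ ∀ x, fderiv ℝ p x x = j * p x := by
  have hpe : p = fun x => ∑ d ∈ P.support, P.coeff d * ∏ i, ((x i : ℝ) : ℂ) ^ d i := by
    ext x; rw [hpP, MvPolynomial.eval_eq']
  have hc : ContDiff ℝ 2 p := by
    rw [hpe]
    refine ContDiff.sum fun d _ => contDiff_const.mul (contDiff_prod fun i _ => ContDiff.pow ?_ _)
    exact (Complex.ofRealCLM.comp (EuclideanSpace.proj (𝕜 := ℝ) i)).contDiff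
  refine ⟨hc, fun x => ?_⟩
  have hom : ∀ τ : ℝ, p (τ • x) = (τ : ℂ) ^ j * p x := by
    intro τ
    rw [hpe]
    simp only [Finset.mul_sum]
    refine Finset.sum_congr rfl fun d hd => ?_
    have hdeg : ∑ i, d i = j := by
      have := hP (MvPolynomial.mem_support_iff.mp hd)
      rw [← this, Finsupp.weight_apply, Finsupp.sum_fintype] <;> simp
    simp [mul_pow, Finset.prod_mul_distrib, Finset.prod_pow_eq_pow_sum, hdeg]
    ring
  have a1 : HasDerivAt (fun τ : ℝ => p (τ • x)) (fderiv ℝ p x x) 1 := by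
    have hl : HasDerivAt (fun τ : ℝ => τ • x) x 1 := by
      simpa using (hasDerivAt_id (1:ℝ)).smul_const x
    have hf : HasFDerivAt p (fderiv ℝ p x) ((1:ℝ) • x) := by
      rw [one_smul]; exact (hc.differentiable (by norm_num) x).hasFDerivAt
    exact hf.comp_hasDerivAt _ hl
  have a2 : HasDerivAt (fun τ : ℝ => p (τ • x)) (j * p x) 1 := by
    simp only [hom]
    have := ((HasDerivAt.ofReal_comp (hasDerivAt_id (1:ℝ))).pow j).mul_const (p x)
    simpa using! this
  exact a1.unique a2

open Topology Filter in
/-- second derivative of `E * y(X)` with log-derivative data. -/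
lemma aux_second {S : Set ℝ} (hS : IsOpen S) {E L M : ℝ → ℂ} {X Z V : ℝ → ℝ} {y y1 y2 : ℝ → ℂ}
    (hE : ∀ τ ∈ S, HasDerivAt E (E τ * L τ) τ)
    (hL : ∀ τ ∈ S, HasDerivAt L (M τ) τ)
    (hX : ∀ τ ∈ S, HasDerivAt X (Z τ) τ)
    (hZ : ∀ τ ∈ S, HasDerivAt Z (V τ) τ)
    (hy : ∀ τ ∈ S, HasDerivAt y (y1 (X τ)) (X τ))
    (hy1 : ∀ τ ∈ S, HasDerivAt y1 (y2 (X τ)) (X τ)) {τ : ℝ} (hτ : τ ∈ S) :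
    (∀ᶠ ρ in 𝓝 τ, HasDerivAt (fun ρ => E ρ * y (X ρ))
      (E ρ * (L ρ * y (X ρ) + Z ρ * y1 (X ρ))) ρ) ∧
    HasDerivAt (fun ρ => E ρ * (L ρ * y (X ρ) + Z ρ * y1 (X ρ)))
      (E τ * ((L τ ^ 2 + M τ) * y (X τ) + (2 * L τ * Z τ + V τ) * y1 (X τ)
        + Z τ ^ 2 * y2 (X τ))) τ := by
  have cy : ∀ τ ∈ S, HasDerivAt (fun ρ => y (X ρ)) (Z τ * y1 (X τ)) τ := fun τ h => by
    simpa using! (hy τ h).scomp τ (hX τ h)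
  have cy1 : ∀ τ ∈ S, HasDerivAt (fun ρ => y1 (X ρ)) (Z τ * y2 (X τ)) τ := fun τ h => by
    simpa using! (hy1 τ h).scomp τ (hX τ h)
  constructor
  · filter_upwards [hS.mem_nhds hτ] with ρ hρ
    convert! (hE ρ hρ).mul (cy ρ hρ) using 1
    ring
  · convert! (hE τ hτ).mul (((hL τ hτ).mul (cy τ hτ)).add
      ((hZ τ hτ).ofReal_comp.mul (cy1 τ hτ))) using 1
    simp only [Pi.add_apply, Pi.mul_apply]
    ring

lemma aux_cpow (q : ℂ) {w : ℝ → ℝ} {w' τ : ℝ} (hw : HasDerivAt w w' τ) (h : 0 < w τ) :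
    HasDerivAt (fun ρ => ((w ρ : ℝ) : ℂ) ^ q) (((w τ : ℝ) : ℂ) ^ q * (q * w' / w τ)) τ := by
  have h0 : ((w τ : ℝ) : ℂ) ≠ 0 := by exact_mod_cast h.ne'
  have := (hasDerivAt_id ((w τ : ℝ) : ℂ)).cpow_const (c := q) (Complex.ofReal_mem_slitPlane.2 h)
  have h2 := HasDerivAt.comp τ this hw.ofReal_comp
  convert! h2 using 1
  simp only [id, Complex.cpow_sub _ _ h0, Complex.cpow_one]
  field_simp

open Topology Filter in
lemma aux_time {f g g1 : ℝ → ℂ} {g2 : ℂ} {t : ℝ} (q : ℂ) (h0 : ∀ᶠ τ in 𝓝 t, f τ = q * g τ)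
    (h1 : ∀ᶠ τ in 𝓝 t, HasDerivAt g (g1 τ) τ) (h2 : HasDerivAt g1 g2 t) :
    deriv (fun s' => deriv (fun s'' => f s'') s') t = q * g2 := by
  have e0 : (fun s' => deriv (fun s'' => f s'') s') =ᶠ[𝓝 t] fun τ => q * g1 τ := by
    filter_upwards [h1, h0.eventually_nhds] with τ hτ hτ0
    have e1 : (fun s'' => f s'') =ᶠ[𝓝 τ] fun τ => q * g τ := hτ0
    rw [e1.deriv_eq]
    exact (hτ.const_mul q).deriv
  rw [e0.deriv_eq]
  exact (h2.const_mul q).deriv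

lemma aux_factor {r t : ℝ} (hr : 0 < r) (hw : 0 < t + r) (j : ℕ) (α : ℝ) (β b μ : ℂ)
    (hb : b = β + α) (hμ : μ = α - j) :
    1 / (r : ℂ) ^ j * ((t + r : ℝ) : ℂ) ^ (-β) * (((2 * r / (t + r)) ^ α : ℝ) : ℂ)
      = (((2 : ℝ) ^ α : ℝ) : ℂ) * ((r : ℂ) ^ μ * ((t + r : ℝ) : ℂ) ^ (-b)) := by
  have hr0 : (r : ℂ) ≠ 0 := by exact_mod_cast hr.ne'
  have hw0 : ((t + r : ℝ) : ℂ) ≠ 0 := by exact_mod_cast hw.ne'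
  have hwa : ((t + r : ℝ) : ℂ) ^ (α : ℂ) ≠ 0 := fun h => hw0 ((Complex.cpow_eq_zero_iff _ _).1 h).1
  rw [Real.div_rpow (by positivity) hw.le, Real.mul_rpow (by norm_num) hr.le, hb, hμ,
    neg_add, Complex.cpow_add _ _ hw0, Complex.cpow_sub _ _ hr0, Complex.cpow_natCast,
    Complex.ofReal_div, Complex.ofReal_mul, Complex.ofReal_cpow hr.le, Complex.ofReal_cpow hw.le,
    Complex.cpow_neg _ (α : ℂ)]
  field_simp

/-- the algebraic identity -/
lemma aux_alg (r t μ b y y1 y2 N l α j : ℂ) (hr : r ≠ 0) (hw : t + r ≠ 0)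
    (hμ : μ = α - j) (hl : l = α * (α + N - 2) - j * (j + N - 2))
    (h : (2 * r / (t + r)) * (1 - 2 * r / (t + r)) * y2
      + ((2 * α + N - 1) - ((2 * α + N - 1) / 2 + b + 1) * (2 * r / (t + r))) * y1
      - (2 * α + N - 1) / 2 * b * y = 0) :
    (((-b / (t + r)) ^ 2 + b / (t + r) ^ 2) * y
      + (2 * (-b / (t + r)) * (-2 * r / (t + r) ^ 2) + 4 * r / (t + r) ^ 3) * y1
      + (-2 * r / (t + r) ^ 2) ^ 2 * y2)
    - ((((μ / r - b / (t + r)) ^ 2 + (-μ / r ^ 2 + b / (t + r) ^ 2)) * y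
      + (2 * (μ / r - b / (t + r)) * (2 * t / (t + r) ^ 2) + -4 * t / (t + r) ^ 3) * y1
      + (2 * t / (t + r) ^ 2) ^ 2 * y2)
      + (2 * j + N - 1) / r * ((μ / r - b / (t + r)) * y + 2 * t / (t + r) ^ 2 * y1))
    + l / r ^ 2 * y = 0 := by
  subst hμ hl
  have := congrArg (fun z => (-2 / (r * (t + r))) * z) h
  simp only [mul_zero] at this
  rw [← this]
  field_simp
  ring

/-- From solutions of the hypergeometric equation to solutions of the wave equation with
inverse-square potential: with `p` a harmonic homogeneous polynomial of degree `j`,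
`λ = j(j+n−2)`, `s = √(((n−2)/2)² + λ + ϝ)`, `α = −(n−2)/2 + s`, `a = 1/2+s`,
`b = 1/2+s+iσ`, `c = 1+2s`, if `y` solves the hypergeometric equation on `(0,1)`, then
`u(t,x) = p(x)|x|^{−j}(t+|x|)^{−(iσ+(n−1)/2)} (2|x|/(t+|x|))^α y(2|x|/(t+|x|))`
solves `∂ₜ²u − Δu + ϝ|x|^{−2}u = 0` on `{0 < |x| < t}`. -/
theorem stmt7 (n j : ℕ) (hn : 3 ≤ n)
    (p : EuclideanSpace ℝ (Fin n) → ℂ)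
    (P : MvPolynomial (Fin n) ℂ) (hP : P.IsHomogeneous j)
    (hpP : ∀ x : EuclideanSpace ℝ (Fin n),
      p x = MvPolynomial.eval (fun i => ((x i : ℝ) : ℂ)) P)
    (hharm : ∀ x, lap p x = 0)
    (ϝ : ℝ)
    (hpos : 0 < (((n : ℝ) - 2) / 2) ^ 2 + ((j * (j + n - 2) : ℕ) : ℝ) + ϝ)
    (s : ℝ)
    (hs : s = Real.sqrt ((((n : ℝ) - 2) / 2) ^ 2 + ((j * (j + n - 2) : ℕ) : ℝ) + ϝ))
    (α : ℝ) (hα : α = -(((n : ℝ) - 2) / 2) + s)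
    (σ : ℂ) (a b c : ℂ)
    (ha : a = 1 / 2 + (s : ℂ)) (hb : b = 1 / 2 + (s : ℂ) + Complex.I * σ)
    (hc : c = 1 + 2 * (s : ℂ))
    (y : ℝ → ℂ) (hy : ContDiffOn ℝ 2 y (Set.Ioo 0 1))
    (hyeq : ∀ x ∈ Set.Ioo (0 : ℝ) 1, hypergeomEq a b c y x)
    (u : ℝ → EuclideanSpace ℝ (Fin n) → ℂ)
    (hu : ∀ (t : ℝ) (x : EuclideanSpace ℝ (Fin n)),
      u t x = p x / (‖x‖ : ℂ) ^ j
        * ((t + ‖x‖ : ℝ) : ℂ) ^ (-(Complex.I * σ + ((n : ℂ) - 1) / 2))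
        * (((2 * ‖x‖ / (t + ‖x‖)) ^ α : ℝ) : ℂ)
        * y (2 * ‖x‖ / (t + ‖x‖))) :
    ∀ (t : ℝ) (x : EuclideanSpace ℝ (Fin n)), 0 < ‖x‖ → ‖x‖ < t →
      deriv (fun s' => deriv (fun s'' => u s'' x) s') t
        - lap (fun y' => u t y') x
        + (ϝ : ℂ) / (‖x‖ : ℂ) ^ 2 * u t x = 0 := by
  intro t x hx0 hxt
  obtain ⟨hpc, heul⟩ := aux_poly hP hpP
  have hxne : x ≠ 0 := norm_pos_iff.1 hx0
  set r := ‖x‖ with hrdef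
  set A : ℂ := (((2 : ℝ) ^ α : ℝ) : ℂ) with hA
  set μ : ℂ := (α : ℂ) - j with hμ
  set β : ℂ := Complex.I * σ + ((n : ℂ) - 1) / 2 with hβ
  have hbβ : b = β + α := by rw [hb, hβ, hα]; push_cast; ring
  let E : ℝ → ℝ → ℂ := fun τ ρ => A * ((ρ : ℂ) ^ μ * ((τ + ρ : ℝ) : ℂ) ^ (-b))
  have hform : ∀ τ z, 0 < ‖z‖ → 0 < τ →
      u τ z = p z * (E τ ‖z‖ * y (2 * ‖z‖ / (τ + ‖z‖))) := by
    intro τ z hz hτ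
    have := aux_factor hz (add_pos hτ hz) j α β b μ hbβ hμ
    rw [hu]
    simp only [E]
    rw [← this]
    ring
  -- y data
  have hyd : ∀ q ∈ Set.Ioo (0:ℝ) 1, HasDerivAt y (deriv y q) q := fun q hq =>
    ((hy.differentiableOn (by norm_num)).differentiableAt (isOpen_Ioo.mem_nhds hq)).hasDerivAt
  have hyd1 : ∀ q ∈ Set.Ioo (0:ℝ) 1, HasDerivAt (deriv y) (deriv (deriv y) q) q := fun q hq =>
    (((hy.deriv_of_isOpen isOpen_Ioo (m := 1) (by norm_num)).differentiableOn
      (by norm_num)).differentiableAt (isOpen_Ioo.mem_nhds hq)).hasDerivAt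
  have hX01 : ∀ τ ρ : ℝ, 0 < ρ → ρ < τ → 2 * ρ / (τ + ρ) ∈ Set.Ioo (0:ℝ) 1 := by
    intro τ ρ h1 h2
    have : 0 < τ + ρ := by linarith
    exact ⟨by positivity, by rw [div_lt_one this]; linarith⟩
  have hwt : ∀ τ ρ : ℝ, HasDerivAt (fun τ => τ + ρ) 1 τ := fun τ ρ =>
    (hasDerivAt_id τ).add_const ρ
  have hwr : ∀ τ ρ : ℝ, HasDerivAt (fun ρ => τ + ρ) 1 ρ := fun τ ρ =>
    (hasDerivAt_id ρ).const_add τ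
  have ht0 : 0 < t := hx0.trans hxt
  -- time
  obtain ⟨T1, T2⟩ := aux_second (S := Set.Ioi r) isOpen_Ioi (E := fun τ => E τ r)
    (L := fun τ => -b / ((τ + r : ℝ) : ℂ)) (M := fun τ => b / ((τ + r : ℝ) : ℂ) ^ 2)
    (X := fun τ => 2 * r / (τ + r)) (Z := fun τ => -2 * r / (τ + r) ^ 2)
    (V := fun τ => 4 * r / (τ + r) ^ 3) (y := y) (y1 := deriv y) (y2 := deriv (deriv y))
    (by
      intro τ hτ
      have hτ' : r < τ := hτ
      have hw : 0 < τ + r := by linarith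
      convert! ((aux_cpow (-b) (hwt τ r) hw).const_mul ((r : ℂ) ^ μ)).const_mul A using 1
      simp only [E, Complex.ofReal_one]
      ring)
    (by
      intro τ hτ
      have hτ' : r < τ := hτ
      have hw : ((τ + r : ℝ) : ℂ) ≠ 0 := by exact_mod_cast (show 0 < τ + r by linarith).ne'
      convert! (hasDerivAt_const τ (-b)).div (hwt τ r).ofReal_comp hw using 1
      simp)
    (by
      intro τ hτ
      have hτ' : r < τ := hτ
      have hw : τ + r ≠ 0 := (show 0 < τ + r by linarith).ne'
      convert! (hasDerivAt_const τ (2 * r)).div (hwt τ r) hw using 1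
      simp)
    (by
      intro τ hτ
      have hτ' : r < τ := hτ
      have hw : τ + r ≠ 0 := (show 0 < τ + r by linarith).ne'
      convert! (hasDerivAt_const τ (-2 * r)).div ((hwt τ r).pow 2) (pow_ne_zero 2 hw) using 1
      simp
      field_simp
      ring)
    (fun τ hτ => hyd _ (hX01 τ r hx0 hτ)) (fun τ hτ => hyd1 _ (hX01 τ r hx0 hτ))
    (τ := t) hxt
  obtain ⟨R1, R2⟩ := aux_second (S := Set.Ioo 0 t) isOpen_Ioo (E := fun ρ => E t ρ)
    (L := fun ρ => μ / (ρ : ℂ) - b / ((t + ρ : ℝ) : ℂ))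
    (M := fun ρ => -μ / (ρ : ℂ) ^ 2 + b / ((t + ρ : ℝ) : ℂ) ^ 2)
    (X := fun ρ => 2 * ρ / (t + ρ)) (Z := fun ρ => 2 * t / (t + ρ) ^ 2)
    (V := fun ρ => -4 * t / (t + ρ) ^ 3) (y := y) (y1 := deriv y) (y2 := deriv (deriv y))
    (by
      intro ρ hρ
      have hw : 0 < t + ρ := by linarith [hρ.1]
      convert! ((aux_cpow μ (hasDerivAt_id ρ) hρ.1).mul
        (aux_cpow (-b) (hwr t ρ) hw)).const_mul A using 1
      simp only [E, Complex.ofReal_one, id]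
      ring)
    (by
      intro ρ hρ
      have h0 : ((id ρ : ℝ) : ℂ) ≠ 0 := by exact_mod_cast hρ.1.ne'
      have hw : ((t + ρ : ℝ) : ℂ) ≠ 0 := by
        exact_mod_cast (show 0 < t + ρ by linarith [hρ.1]).ne'
      convert! ((hasDerivAt_const ρ μ).div (hasDerivAt_id ρ).ofReal_comp h0).sub
        ((hasDerivAt_const ρ b).div (hwr t ρ).ofReal_comp hw) using 1
      simp
      ring)
    (by
      intro ρ hρ
      have hw : t + ρ ≠ 0 := (show 0 < t + ρ by linarith [hρ.1]).ne'
      convert! ((hasDerivAt_id ρ).const_mul 2).div (hwr t ρ) hw using 1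
      simp
      ring)
    (by
      intro ρ hρ
      have hw : t + ρ ≠ 0 := (show 0 < t + ρ by linarith [hρ.1]).ne'
      convert! (hasDerivAt_const ρ (2 * t)).div ((hwr t ρ).pow 2) (pow_ne_zero 2 hw) using 1
      simp
      field_simp
      ring)
    (fun ρ hρ => hyd _ (hX01 t ρ hρ.1 hρ.2)) (fun ρ hρ => hyd1 _ (hX01 t ρ hρ.1 hρ.2))
    (τ := r) ⟨hx0, hxt⟩
  clear_value E
  have hL := aux_lap hxne hpc R1 R2
  have hlap : lap (fun y' => u t y') x
      = lap (fun z => p z * (E t ‖z‖ * y (2 * ‖z‖ / (t + ‖z‖)))) x := by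
    have e0 : ∀ᶠ z in nhds x, u t z = p z * (E t ‖z‖ * y (2 * ‖z‖ / (t + ‖z‖))) := by
      filter_upwards [isOpen_ne.mem_nhds hxne] with z hz
      exact hform t z (norm_pos_iff.2 hz) ht0
    unfold lap
    refine Finset.sum_congr rfl fun i _ => ?_
    have e1 := e0.eventually_nhds
    have e2 : (fun w => fderiv ℝ (fun y' => u t y') w (EuclideanSpace.single i 1)) =ᶠ[nhds x]
        (fun w => fderiv ℝ (fun z => p z * (E t ‖z‖ * y (2 * ‖z‖ / (t + ‖z‖)))) w
          (EuclideanSpace.single i 1)) := by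
      filter_upwards [e1] with w hw
      have hw' : (fun y' => u t y') =ᶠ[nhds w]
        (fun z => p z * (E t ‖z‖ * y (2 * ‖z‖ / (t + ‖z‖)))) := hw
      rw [hw'.fderiv_eq]
    rw [e2.fderiv_eq]
  have htime := aux_time (f := fun τ => u τ x) (p x) (by
    filter_upwards [isOpen_Ioi.mem_nhds ht0] with τ' h'
    exact hform τ' x hx0 h') T1 T2
  rw [htime, hlap, hL, hharm, heul, hform t x hx0 ht0]
  have hr0 : (r : ℂ) ≠ 0 := by exact_mod_cast hx0.ne'
  have hw0 : (t : ℂ) + (r : ℂ) ≠ 0 := by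
    exact_mod_cast (show 0 < t + r by linarith).ne'
  have hs2 : s ^ 2 = (((n : ℝ) - 2) / 2) ^ 2 + (j : ℝ) * (j + n - 2) + ϝ := by
    rw [hs, Real.sq_sqrt hpos.le]
    push_cast [Nat.cast_sub (show 2 ≤ j + n by omega)]
    ring
  have hl : (ϝ : ℂ) = (α : ℂ) * (α + n - 2) - j * (j + n - 2) := by
    have : ϝ = α * (α + n - 2) - j * (j + n - 2) := by
      rw [hα]; linear_combination -hs2
    rw [this]; push_cast; ring
  have hh := hyeq _ (hX01 t r hx0 hxt)
  unfold hypergeomEq at hh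
  have hα' : (s : ℂ) = α + ((n : ℂ) - 2) / 2 := by rw [hα]; push_cast; ring
  have hfin := aux_alg (r : ℂ) t μ b (y (2 * r / (t + r))) (deriv y (2 * r / (t + r)))
    (deriv (deriv y) (2 * r / (t + r))) n ϝ α j hr0 hw0 hμ hl (by
      rw [ha, hc, hα'] at hh
      push_cast at hh
      linear_combination hh)
  have hfin2 := congrArg (fun z => p x * E t r * z) hfin
  simp only [mul_zero] at hfin2
  simp only [← hrdef]
  push_cast
  linear_combination hfin2
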